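/- Fix λ > 0, C_d > 0 and 0 < τ_min ≤ T. If 1 − λ C_d < (1 + λ τ + λ² τ²/2) e^{−λ τ} for every τ ∈ [τ_min, T], then the function τ ↦ u_d(τ, λ) = −(τ − ∫₀^{τ} e^{−λ s} ds + C_d)/τ is strictly concave on [τ_min, T]. (Its second derivative equals (2/(λ τ³))·((1 − λ C_d) − (1 + λ τ + λ² τ²/2) e^{−λ τ}), which is negative under the stated inequality.) -/

import Mathlib

open MeasureTheory Set Real

/-- Attacker payoff in the specific instantiation `G(τ_d,τ_a) = τ_d − τ_a`,
`f(τ_a; λ) = λ e^{−λ τ_a}`: `u_a(τ_d, λ) = τ_d − ∫₀^{τ_d} e^{−λ s} ds − λ C_a`. -/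
noncomputable def uaExp (Ca τd l : ℝ) : ℝ :=
  τd - (∫ s in (0:ℝ)..τd, Real.exp (-l * s)) - l * Ca

/-- Defender payoff in the specific instantiation:
`u_d(τ_d, λ) = −(τ_d − ∫₀^{τ_d} e^{−λ s} ds + C_d)/τ_d`. -/
noncomputable def udExp (Cd τd l : ℝ) : ℝ :=
  -(τd - (∫ s in (0:ℝ)..τd, Real.exp (-l * s)) + Cd) / τd

theorem integral_exp_neg_mul {l : ℝ} (hl : l ≠ 0) (τ : ℝ) :
    ∫ s in (0 : ℝ)..τ, Real.exp (-l * s) = (1 - Real.exp (-l * τ)) / l := by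
  rw [intervalIntegral.integral_comp_mul_left _ (neg_ne_zero.mpr hl), integral_exp]
  simp only [mul_zero, Real.exp_zero, smul_eq_mul]
  field_simp
  ring

theorem hasDerivAt_exp_neg_mul (l τ : ℝ) :
    HasDerivAt (fun t => Real.exp (-l * t)) (-l * Real.exp (-l * τ)) τ := by
  simpa [mul_comm] using ((hasDerivAt_id τ).const_mul (-l)).exp

theorem hasDerivAt_udExp {l : ℝ} (hl : l ≠ 0) (Cd : ℝ) {τ : ℝ} (hτ : τ ≠ 0) :
    HasDerivAt (fun t => udExp Cd t l)
      (((1 + l * τ) * Real.exp (-l * τ) - (1 - l * Cd)) / (l * τ ^ 2)) τ := by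
  simp only [udExp, integral_exp_neg_mul hl]
  have h := ((((hasDerivAt_id' τ).fun_sub
    (((hasDerivAt_exp_neg_mul l τ).const_sub 1).div_const l)).add_const Cd).fun_neg).fun_div
    (hasDerivAt_id' τ) hτ
  refine h.congr_deriv ?_
  field_simp
  ring

theorem hasDerivAt_deriv_udExp {l : ℝ} (hl : l ≠ 0) (Cd : ℝ) {τ : ℝ} (hτ : τ ≠ 0) :
    HasDerivAt (deriv fun t => udExp Cd t l)
      (2 / (l * τ ^ 3) *
        ((1 - l * Cd) - (1 + l * τ + l ^ 2 * τ ^ 2 / 2) * Real.exp (-l * τ))) τ := by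
  have h := (((((hasDerivAt_id' τ).const_mul l).const_add 1).fun_mul
    (hasDerivAt_exp_neg_mul l τ)).sub_const (1 - l * Cd)).fun_div
    ((hasDerivAt_pow 2 τ).const_mul l) (mul_ne_zero hl (pow_ne_zero 2 hτ))
  refine HasDerivAt.congr_of_eventuallyEq (f := fun t =>
    ((1 + l * t) * Real.exp (-l * t) - (1 - l * Cd)) / (l * t ^ 2)) ?_ ?_
  · refine h.congr_deriv ?_
    push_cast
    field_simp
    ring
  · filter_upwards [isOpen_ne.mem_nhds hτ] with t ht
    exact (hasDerivAt_udExp hl Cd ht).deriv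

/-- If `1 − λ C_d < (1 + λ τ + λ² τ²/2) e^{−λ τ}` for every `τ ∈ [τ_min, T]`, then the
defender's payoff `τ ↦ u_d(τ, λ)` is strictly concave on `[τ_min, T]`. -/
theorem udExp_strictConcaveOn
    (l Cd τmin T : ℝ) (hl : 0 < l) (hCd : 0 < Cd)
    (hτmin : 0 < τmin) (hτT : τmin ≤ T)
    (hcond : ∀ τ ∈ Icc τmin T,
      1 - l * Cd < (1 + l * τ + l ^ 2 * τ ^ 2 / 2) * Real.exp (-l * τ)) :
    StrictConcaveOn ℝ (Icc τmin T) (fun τ => udExp Cd τ l) := by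
  refine strictConcaveOn_of_deriv2_neg' (convex_Icc τmin T) (fun τ hτ => ?_) fun τ hτ => ?_
  · exact (hasDerivAt_udExp hl.ne' Cd (hτmin.trans_le hτ.1).ne').continuousAt.continuousWithinAt
  · have hτ0 : 0 < τ := hτmin.trans_le hτ.1
    change deriv (deriv fun t => udExp Cd t l) τ < 0
    rw [(hasDerivAt_deriv_udExp hl.ne' Cd hτ0.ne').deriv]
    exact mul_neg_of_pos_of_neg (by positivity) (sub_neg.mpr (hcond τ hτ))
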